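/- Suppose for every ε > 0 there exists a stopping time σ_ε ≤ N and a predictable bounded process γ^ε such that the wealth process V^ε with initial capital 𝕍 + ε satisfies V^ε_{σ_ε ∧ l} ≥ H(σ_ε, l) pathwise for all l ≤ N. Then 𝕍 ≥ inf_{σ} sup_{P ∈ M} sup_{τ} E_P[H(σ, τ, Z)], where M is the set of martingale laws supported on the path space K and σ, τ range over stopping times of the canonical filtration with values in {0,...,N}. -/

import Mathlib

open MeasureTheory

/-- The set K of admissible price paths. -/
def pathSet (N : ℕ) (s a b : ℝ) : Set (Fin (N + 1) → ℝ) :=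
  {x | (∀ i, 0 < x i) ∧ x 0 = s ∧
    ∀ i : Fin N, |Real.log (x i.succ) - Real.log (x i.castSucc)| ∈ Set.Icc a b}

/-- A function of the path depends only on the first k+1 coordinates. -/
def depOnFirst (N : ℕ) (k : ℕ) (f : (Fin (N + 1) → ℝ) → ℝ) : Prop :=
  ∀ u v : Fin (N + 1) → ℝ, (∀ i : Fin (N + 1), (i : ℕ) ≤ k → u i = v i) → f u = f v

/-- A (pathwise) stopping time with values in {0,...,N}. -/
def isPathStopping (N : ℕ) (σ : (Fin (N + 1) → ℝ) → ℕ) : Prop :=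
  Measurable σ ∧ (∀ u, σ u ≤ N) ∧
    ∀ u v : Fin (N + 1) → ℝ, (∀ i : Fin (N + 1), (i : ℕ) ≤ σ u → u i = v i) → σ v = σ u

/-- The set M of martingale laws supported on the path set K, characterized by
bounded measurable adapted test functions. -/
def martLaws (N : ℕ) (s a b : ℝ) : Set (Measure (Fin (N + 1) → ℝ)) :=
  {P | IsProbabilityMeasure P ∧ P (pathSet N s a b) = 1 ∧
    ∀ k : Fin (N + 1), ∀ f : (Fin (N + 1) → ℝ) → ℝ, Measurable f →
      (∃ C, ∀ x, |f x| ≤ C) → depOnFirst N k f →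
      ∫ x, (x (Fin.last N) - x k) * f x ∂P = 0}

/-- Portfolio value at time k of the self-financing strategy γ with initial capital x. -/
def wealth (N : ℕ) (x : ℝ) (γ : Fin N → (Fin (N + 1) → ℝ) → ℝ) (k : ℕ)
    (S : Fin (N + 1) → ℝ) : ℝ :=
  x + ∑ i ∈ Finset.univ.filter (fun i : Fin N => (i : ℕ) < k),
    γ i S * (S i.succ - S i.castSucc)

/-- Game-option payoff H(k,l,S) = G_k(S)·1_{k<l} + F_l(S)·1_{l≤k}. -/
def gamePayoff (N : ℕ) (F G : ℕ → (Fin (N + 1) → ℝ) → ℝ) (k l : ℕ)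
    (S : Fin (N + 1) → ℝ) : ℝ :=
  if k < l then G k S else F l S

lemma depOnFirst.mono {N k l : ℕ} {f : (Fin (N + 1) → ℝ) → ℝ} (hf : depOnFirst N k f)
    (hkl : k ≤ l) : depOnFirst N l f :=
  fun u v h => hf u v fun i hi => h i (hi.trans hkl)

lemma isPathStopping.lt_iff {N k : ℕ} {σ : (Fin (N + 1) → ℝ) → ℕ} (hσ : isPathStopping N σ)
    {u v : Fin (N + 1) → ℝ} (h : ∀ i : Fin (N + 1), (i : ℕ) ≤ k → u i = v i) :
    k < σ u ↔ k < σ v := by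
  rw [← not_iff_not, not_lt, not_lt]
  constructor
  · intro hu
    rwa [hσ.2.2 u v fun i hi => h i (hi.trans hu)]
  · intro hv
    rwa [hσ.2.2 v u fun i hi => (h i (hi.trans hv)).symm]

lemma pathSet_nonempty (N : ℕ) {s a b : ℝ} (hs : 0 < s) (ha : 0 ≤ a) (hab : a ≤ b) :
    (pathSet N s a b).Nonempty := by
  refine ⟨fun i => s * Real.exp (a * (i : ℕ)), fun i => by positivity, by simp, fun i => ?_⟩
  have h : Real.log (s * Real.exp (a * (i.succ : ℕ)))
      - Real.log (s * Real.exp (a * (i.castSucc : ℕ))) = a := by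
    rw [Real.log_mul hs.ne' (Real.exp_ne_zero _), Real.log_mul hs.ne' (Real.exp_ne_zero _),
      Real.log_exp, Real.log_exp]
    simp only [Fin.val_succ, Fin.val_castSucc]
    push_cast
    ring
  rw [h, abs_of_nonneg ha]
  exact ⟨le_rfl, hab⟩

lemma measurableSet_pathSet (N : ℕ) (s a b : ℝ) : MeasurableSet (pathSet N s a b) := by
  have h : pathSet N s a b = (⋂ i, {x | 0 < x i}) ∩ ({x | x 0 = s} ∩
      ⋂ i : Fin N, {x | |Real.log (x i.succ) - Real.log (x i.castSucc)| ∈ Set.Icc a b}) := by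
    ext x
    simp [pathSet]
  rw [h]
  refine (MeasurableSet.iInter fun i => ?_).inter
    (MeasurableSet.inter ?_ (MeasurableSet.iInter fun i => ?_))
  · exact measurableSet_lt measurable_const (measurable_pi_apply i)
  · exact measurableSet_eq_fun (measurable_pi_apply 0) measurable_const
  · have hm : Measurable fun x : Fin (N + 1) → ℝ =>
        |Real.log (x i.succ) - Real.log (x i.castSucc)| := by
      have h1 := Real.measurable_log.comp (measurable_pi_apply (X := fun _ => ℝ) i.succ)
      have h2 := Real.measurable_log.comp (measurable_pi_apply (X := fun _ => ℝ) i.castSucc)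
      exact continuous_abs.measurable.comp (h1.sub h2)
    exact hm measurableSet_Icc

lemma abs_apply_le_of_mem_pathSet {N : ℕ} {s a b : ℝ} {x : Fin (N + 1) → ℝ}
    (hx : x ∈ pathSet N s a b) (j : Fin (N + 1)) : |x j| ≤ s * Real.exp (b * (j : ℕ)) := by
  rw [abs_of_pos (hx.1 j)]
  induction j using Fin.induction with
  | zero => simp [hx.2.1]
  | succ i ih =>
    have hlog : Real.log (x i.succ) ≤ Real.log (x i.castSucc) + b := by
      linarith [(abs_le.mp (hx.2.2 i).2).2]
    calc x i.succ = Real.exp (Real.log (x i.succ)) := (Real.exp_log (hx.1 _)).symm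
      _ ≤ Real.exp (Real.log (x i.castSucc) + b) := Real.exp_le_exp.mpr hlog
      _ = x i.castSucc * Real.exp b := by rw [Real.exp_add, Real.exp_log (hx.1 _)]
      _ ≤ s * Real.exp (b * (i.castSucc : ℕ)) * Real.exp b := by gcongr
      _ = s * Real.exp (b * (i.succ : ℕ)) := by
        rw [mul_assoc, ← Real.exp_add]
        simp only [Fin.val_succ, Fin.val_castSucc]
        push_cast
        ring_nf

section MartLaws

variable {N : ℕ} {s a b : ℝ} {P : Measure (Fin (N + 1) → ℝ)}

lemma ae_mem_pathSet (hP : P ∈ martLaws N s a b) : ∀ᵐ x ∂P, x ∈ pathSet N s a b := by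
  have := hP.1
  exact (mem_ae_iff_prob_eq_one (measurableSet_pathSet N s a b)).mpr hP.2.1

lemma integrable_apply_mul (hP : P ∈ martLaws N s a b) (j : Fin (N + 1))
    {f : (Fin (N + 1) → ℝ) → ℝ} (hf : Measurable f) (hfb : ∃ C, ∀ x, |f x| ≤ C) :
    Integrable (fun x => x j * f x) P := by
  have := hP.1
  obtain ⟨C, hC⟩ := hfb
  refine Integrable.of_bound ((measurable_pi_apply j).mul hf).aestronglyMeasurable
    (s * Real.exp (b * (j : ℕ)) * C) ?_
  filter_upwards [ae_mem_pathSet hP] with x hx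
  have hj := abs_apply_le_of_mem_pathSet hx j
  rw [Real.norm_eq_abs, abs_mul]
  exact mul_le_mul hj (hC x) (abs_nonneg _) ((abs_nonneg _).trans hj)

lemma integrable_mul_increment (hP : P ∈ martLaws N s a b) (i : Fin N)
    {f : (Fin (N + 1) → ℝ) → ℝ} (hf : Measurable f) (hfb : ∃ C, ∀ x, |f x| ≤ C) :
    Integrable (fun x => f x * (x i.succ - x i.castSucc)) P := by
  refine ((integrable_apply_mul hP i.succ hf hfb).sub
    (integrable_apply_mul hP i.castSucc hf hfb)).congr (ae_of_all _ fun x => ?_)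
  simp only [Pi.sub_apply]
  ring

lemma integral_mul_increment (hP : P ∈ martLaws N s a b) (i : Fin N)
    {f : (Fin (N + 1) → ℝ) → ℝ} (hf : Measurable f) (hfb : ∃ C, ∀ x, |f x| ≤ C)
    (hfad : depOnFirst N i f) : ∫ x, f x * (x i.succ - x i.castSucc) ∂P = 0 := by
  have h0 := hP.2.2 i.castSucc f hf hfb (hfad.mono (by simp))
  have h1 := hP.2.2 i.succ f hf hfb (hfad.mono (by simp))
  have hint (k : Fin (N + 1)) : Integrable (fun x => (x (Fin.last N) - x k) * f x) P := by
    simp only [sub_mul]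
    exact (integrable_apply_mul hP _ hf hfb).sub (integrable_apply_mul hP _ hf hfb)
  have h := integral_sub (hint i.castSucc) (hint i.succ)
  rw [h0, h1, sub_zero] at h
  rw [← h]
  congr 1
  ext x
  ring

lemma wealth_min_eq (x : ℝ) (γ : Fin N → (Fin (N + 1) → ℝ) → ℝ) (σ τ : ℕ)
    (S : Fin (N + 1) → ℝ) :
    wealth N x γ (min σ τ) S = x + ∑ i : Fin N,
      (if (i : ℕ) < σ ∧ (i : ℕ) < τ then γ i S else 0) * (S i.succ - S i.castSucc) := by
  simp only [wealth, Finset.sum_filter, lt_min_iff, ite_mul, zero_mul]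

/-- Optional stopping: a bounded predictable strategy, stopped at a stopping time, has
constant expected wealth under a martingale law. -/
lemma integral_wealth_min (hP : P ∈ martLaws N s a b) (x : ℝ)
    {γ : Fin N → (Fin (N + 1) → ℝ) → ℝ}
    (hγ : ∀ i : Fin N, Measurable (γ i) ∧ depOnFirst N i (γ i))
    (hγb : ∃ M, ∀ i S, |γ i S| ≤ M) {σ τ : (Fin (N + 1) → ℝ) → ℕ}
    (hσ : isPathStopping N σ) (hτ : isPathStopping N τ) :
    Integrable (fun S => wealth N x γ (min (σ S) (τ S)) S) P ∧
      ∫ S, wealth N x γ (min (σ S) (τ S)) S ∂P = x := by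
  have := hP.1
  obtain ⟨M, hM⟩ := hγb
  have hm (i : Fin N) : Measurable fun S =>
      if (i : ℕ) < σ S ∧ (i : ℕ) < τ S then γ i S else 0 :=
    Measurable.ite ((measurableSet_lt measurable_const hσ.1).inter
      (measurableSet_lt measurable_const hτ.1)) (hγ i).1 measurable_const
  have hb (i : Fin N) : ∃ C, ∀ S,
      |if (i : ℕ) < σ S ∧ (i : ℕ) < τ S then γ i S else 0| ≤ C := by
    refine ⟨M, fun S => ?_⟩
    split_ifs
    · exact hM i S
    · simpa using (abs_nonneg _).trans (hM i S)
  have had (i : Fin N) : depOnFirst N i fun S =>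
      if (i : ℕ) < σ S ∧ (i : ℕ) < τ S then γ i S else 0 := by
    intro u v h
    simp only [hσ.lt_iff h, hτ.lt_iff h, (hγ i).2 u v h]
  have hint (i : Fin N) := integrable_mul_increment hP i (hm i) (hb i)
  have hsum := integrable_finsetSum Finset.univ fun i _ => hint i
  simp only [wealth_min_eq]
  refine ⟨(integrable_const x).add hsum, ?_⟩
  rw [integral_add (integrable_const x) hsum, integral_finsetSum _ fun i _ => hint i,
    Finset.sum_eq_zero fun i _ => integral_mul_increment hP i (hm i) (hb i) (had i)]
  simp

end MartLaws

lemma gamePayoff_nonneg {N : ℕ} {F G : ℕ → (Fin (N + 1) → ℝ) → ℝ} (hF : ∀ k S, 0 ≤ F k S)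
    (hFG : ∀ k S, F k S ≤ G k S) (k l : ℕ) (S : Fin (N + 1) → ℝ) :
    0 ≤ gamePayoff N F G k l S := by
  unfold gamePayoff
  split_ifs
  · exact (hF k S).trans (hFG k S)
  · exact hF l S

/-- Inequality (2.8): if for every ε > 0 there is a perfect hedge (bounded
predictable strategy and stopping time) with initial capital 𝕍 + ε, then
𝕍 ≥ inf_σ sup_{P∈M} sup_τ E_P[H(σ,τ,Z)]. -/
theorem stmt_10 (N : ℕ) (s a b : ℝ) (hs : 0 < s) (ha : 0 ≤ a) (hab : a ≤ b)
    (F G : ℕ → (Fin (N + 1) → ℝ) → ℝ)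
    (hFm : ∀ k, Measurable (F k)) (hGm : ∀ k, Measurable (G k))
    (hFad : ∀ k, depOnFirst N k (F k)) (hGad : ∀ k, depOnFirst N k (G k))
    (hFpos : ∀ k S, 0 ≤ F k S) (hFG : ∀ k S, F k S ≤ G k S)
    (hGb : ∃ C, ∀ k S, G k S ≤ C) (𝕍 : ℝ)
    (hhedge : ∀ ε > 0, ∃ (σ : (Fin (N + 1) → ℝ) → ℕ)
        (γ : Fin N → (Fin (N + 1) → ℝ) → ℝ),
      isPathStopping N σ ∧
      (∀ i : Fin N, Measurable (γ i) ∧ depOnFirst N i (γ i)) ∧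
      (∃ M, ∀ i S, |γ i S| ≤ M) ∧
      ∀ S ∈ pathSet N s a b, ∀ l ≤ N,
        gamePayoff N F G (σ S) l S ≤ wealth N (𝕍 + ε) γ (min (σ S) l) S) :
    (⨅ σ : {σ // isPathStopping N σ}, ⨆ P : martLaws N s a b,
      ⨆ τ : {τ // isPathStopping N τ},
        ∫ S, gamePayoff N F G (σ.1 S) (τ.1 S) S ∂(P : Measure (Fin (N + 1) → ℝ))) ≤ 𝕍 := by
  have hH := gamePayoff_nonneg hFpos hFG
  refine le_of_forall_pos_le_add fun ε hε => ?_
  obtain ⟨σ, γ, hσ, hγ, hγb, hdom⟩ := hhedge ε hε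
  have hV : 0 ≤ 𝕍 + ε := by
    obtain ⟨S, hS⟩ := pathSet_nonempty N hs ha hab
    simpa [wealth] using (hH _ _ _).trans (hdom S hS 0 N.zero_le)
  refine (ciInf_le ⟨0, ?_⟩ ⟨σ, hσ⟩).trans
    (Real.iSup_le (fun P => Real.iSup_le (fun τ => ?_) hV) hV)
  · rintro _ ⟨σ', rfl⟩
    exact Real.iSup_nonneg fun P => Real.iSup_nonneg fun τ =>
      integral_nonneg fun S => hH _ _ S
  · obtain ⟨hint, heq⟩ := integral_wealth_min P.2 (𝕍 + ε) hγ hγb hσ τ.2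
    rw [← heq]
    refine integral_mono_of_nonneg (ae_of_all _ fun S => hH _ _ S) hint ?_
    filter_upwards [ae_mem_pathSet P.2] with S hS
    exact hdom S hS _ (τ.2.2.1 S)
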